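/- For every ε > 0 there exist β > max{1, 2/ε}, constants A > 0 and R₀ > 0, and an entire solution u(x,t) of the heat equation on the lattice ℤ (with ∂_t u(x,t) = u(x+1,t) + u(x−1,t) − 2u(x,t) for all (x,t) ∈ ℤ × ℝ) such that |u(x,t)| ≤ A·exp((1+ε)·x·ln x) for all x ≥ R₀ and all t, yet u is not analytic in t: there exists t₀ such that all time-derivatives of u vanish at (x, t₀) for every x, while u is not identically zero on any interval (t₀, t₀+δ). -/

import Mathlib

open Real Filter

/-- The complex extension of the flat function `t ↦ exp (-t⁻ⁿ)`. -/
noncomputable def flatExp (n : ℕ) (z : ℂ) : ℂ := Complex.exp (-(z⁻¹ ^ n))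

theorem differentiableOn_flatExp (n : ℕ) : DifferentiableOn ℂ (flatExp n) {0}ᶜ := by
  intro z hz
  have hz' : z ≠ 0 := hz
  unfold flatExp
  exact (((differentiableAt_inv hz').pow n).neg.cexp).differentiableWithinAt

theorem hasDerivAt_iteratedDeriv_flatExp (n k : ℕ) {z : ℂ} (hz : z ≠ 0) :
    HasDerivAt (iteratedDeriv k (flatExp n)) (iteratedDeriv (k + 1) (flatExp n) z) z := by
  have ha : AnalyticAt ℂ (flatExp n) z :=
    (differentiableOn_flatExp n).analyticAt (isOpen_compl_singleton.mem_nhds hz)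
  rw [iteratedDeriv_succ]
  rw [iteratedDeriv_eq_iterate]
  exact (ha.iterated_deriv k).differentiableAt.hasDerivAt

theorem exists_ball_re_inv_pow (n : ℕ) :
    ∃ ρ : ℝ, 0 < ρ ∧ ρ < 1 ∧ ∀ w : ℂ, ‖w - 1‖ ≤ ρ → 1 / 2 ≤ (w⁻¹ ^ n).re := by
  have hc : ContinuousAt (fun w : ℂ => (w⁻¹ ^ n).re) 1 :=
    Complex.continuous_re.continuousAt.comp ((continuousAt_inv₀ one_ne_zero).pow n)
  have h : ∀ᶠ w in nhds (1 : ℂ), 1 / 2 < (w⁻¹ ^ n).re :=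
    hc.eventually_const_lt (by norm_num)
  obtain ⟨r, hr, hball⟩ := Metric.eventually_nhds_iff.1 h
  refine ⟨min (r / 2) (1 / 2), by positivity, by
    have := min_le_right (r / 2) (1 / 2); linarith, fun w hw => (hball ?_).le⟩
  have := min_le_left (r / 2) (1 / 2)
  rw [dist_eq_norm]
  linarith

theorem norm_iteratedDeriv_flatExp_le {n : ℕ} {ρ : ℝ} (hρ : 0 < ρ) (hρ1 : ρ < 1)
    (h : ∀ w : ℂ, ‖w - 1‖ ≤ ρ → 1 / 2 ≤ (w⁻¹ ^ n).re) (k : ℕ) {t : ℝ} (ht : 0 < t) :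
    ‖iteratedDeriv k (flatExp n) t‖
      ≤ k.factorial * ρ⁻¹ ^ k * (t⁻¹ ^ k * exp (-(t⁻¹ ^ n / 2))) := by
  have htc : (t : ℂ) ≠ 0 := by exact_mod_cast ht.ne'
  have hsub : Metric.closedBall (t : ℂ) (ρ * t) ⊆ {0}ᶜ := by
    rintro z hz rfl
    have : t ≤ ρ * t := by simpa [abs_of_pos ht] using hz
    nlinarith
  have key := Complex.norm_iteratedDeriv_le_of_forall_mem_sphere_norm_le
    (f := flatExp n) (c := (t : ℂ)) (R := ρ * t) (C := exp (-(t⁻¹ ^ n / 2))) k (by positivity)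
    (((differentiableOn_flatExp n).mono hsub).diffContOnCl_ball subset_rfl) ?_
  · refine key.trans_eq ?_
    rw [mul_pow, inv_pow, inv_pow, div_eq_mul_inv, mul_inv]
    ring
  · intro z hz
    set w : ℂ := z / t with hw
    have hzw : z = t * w := by rw [hw]; field_simp
    have hw1 : ‖w - 1‖ ≤ ρ := by
      have hz' : ‖z - t‖ = ρ * t := by simpa [dist_eq_norm] using hz
      have : w - 1 = (z - t) / t := by rw [hw]; field_simp
      rw [this, norm_div, hz', Complex.norm_real, Real.norm_eq_abs, abs_of_pos ht]
      field_simp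
      exact le_rfl
    have hre : (z⁻¹ ^ n).re = t⁻¹ ^ n * (w⁻¹ ^ n).re := by
      rw [hzw, mul_inv, mul_pow, ← Complex.ofReal_inv, ← Complex.ofReal_pow,
        Complex.re_ofReal_mul]
    rw [flatExp, Complex.norm_exp, Complex.neg_re, hre]
    have := h w hw1
    have hp : 0 < t⁻¹ ^ n := by positivity
    gcongr
    nlinarith

theorem pow_mul_exp_neg_le {n : ℕ} (hn : 2 ≤ n) (k : ℕ) {y : ℝ} (hy : 0 < y) :
    y ^ k * exp (-(y ^ n / 2)) ≤ exp (k * log k / n) := by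
  have hyn : 0 < y ^ n := by positivity
  rw [← exp_log (pow_pos hy k), ← exp_add, exp_le_exp, log_pow]
  rcases Nat.eq_zero_or_pos k with rfl | hk
  · simpa using (half_pos hyn).le
  have hk' : (0 : ℝ) < k := by exact_mod_cast hk
  have hn' : (2 : ℝ) ≤ n := by exact_mod_cast hn
  have h1 : log (y ^ n / k) ≤ y ^ n / k := by
    have := log_le_sub_one_of_pos (div_pos hyn hk'); linarith
  rw [log_div hyn.ne' hk'.ne', log_pow] at h1
  have h2 : k * log y - k * log k / n ≤ y ^ n / n := by
    have h3 := mul_le_mul_of_nonneg_left h1 (by positivity : (0 : ℝ) ≤ k / n)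
    have e1 : (k : ℝ) / n * (n * log y - log k) = k * log y - k * log k / n := by field_simp
    have e2 : (k : ℝ) / n * (y ^ n / k) = y ^ n / n := by field_simp
    rwa [e1, e2] at h3
  have h4 : y ^ n / n ≤ y ^ n / 2 := by gcongr
  linarith

theorem factorial_le_exp_mul_log (k : ℕ) : (k.factorial : ℝ) ≤ exp (k * log k) := by
  rcases Nat.eq_zero_or_pos k with rfl | hk
  · simp
  have hk' : (0 : ℝ) < k := by exact_mod_cast hk
  rw [← log_pow, exp_log (by positivity)]
  exact_mod_cast Nat.factorial_le_pow k

/-- The `k`-th derivative of the function equal to `exp (-t⁻ⁿ)` for `t > 0` and to `0` for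
`t ≤ 0`. -/
noncomputable def flatDeriv (n k : ℕ) (t : ℝ) : ℝ :=
  if 0 < t then (iteratedDeriv k (flatExp n) t).re else 0

theorem hasDerivAt_zero_of_abs_le_sq {f : ℝ → ℝ} (B : ℝ) (hf : ∀ t, |f t| ≤ B * t ^ 2) :
    HasDerivAt f 0 0 := by
  have h0 : f 0 = 0 := by simpa using hf 0
  rw [hasDerivAt_iff_isLittleO]
  have hO : (fun t => f t) =O[nhds 0] fun t : ℝ => t ^ 2 :=
    Asymptotics.IsBigO.of_bound B (Eventually.of_forall fun t => by
      simpa using hf t)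
  simpa [h0] using hO.trans_isLittleO (Asymptotics.isLittleO_pow_id one_lt_two)

theorem exists_flatDeriv_bound {n : ℕ} (hn : 2 ≤ n) :
    ∃ C : ℝ, 1 ≤ C ∧ (∀ k t, |flatDeriv n k t| ≤ C ^ k * exp ((1 + 1 / n) * (k * log k))) ∧
      ∀ k, ∃ B : ℝ, ∀ t, |flatDeriv n k t| ≤ B * t ^ 2 := by
  obtain ⟨ρ, hρ, hρ1, h⟩ := exists_ball_re_inv_pow n
  have key : ∀ k t, 0 < t → |flatDeriv n k t|
      ≤ k.factorial * ρ⁻¹ ^ k * (t⁻¹ ^ k * exp (-(t⁻¹ ^ n / 2))) := fun k t ht => by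
    rw [flatDeriv, if_pos ht]
    exact (Complex.abs_re_le_norm _).trans (norm_iteratedDeriv_flatExp_le hρ hρ1 h k ht)
  refine ⟨ρ⁻¹, (one_le_inv₀ hρ).2 hρ1.le, fun k t => ?_, fun k =>
    ⟨k.factorial * ρ⁻¹ ^ k * exp ((k + 2 : ℕ) * log (k + 2 : ℕ) / n), fun t => ?_⟩⟩
  · by_cases ht : 0 < t
    · calc |flatDeriv n k t|
          ≤ k.factorial * ρ⁻¹ ^ k * (t⁻¹ ^ k * exp (-(t⁻¹ ^ n / 2))) := key k t ht
        _ ≤ exp (k * log k) * ρ⁻¹ ^ k * exp (k * log k / n) := by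
            gcongr
            · exact factorial_le_exp_mul_log k
            · exact pow_mul_exp_neg_le hn k (inv_pos.2 ht)
        _ = ρ⁻¹ ^ k * exp ((1 + 1 / n) * (k * log k)) := by
            rw [mul_comm (exp _), mul_assoc, ← exp_add]
            congr 2
            ring
    · rw [flatDeriv, if_neg ht, abs_zero]
      positivity
  · by_cases ht : 0 < t
    · refine (key k t ht).trans ?_
      have h2 := pow_mul_exp_neg_le hn (k + 2) (inv_pos.2 ht)
      have e : t⁻¹ ^ k * exp (-(t⁻¹ ^ n / 2))
          = (t⁻¹ ^ (k + 2) * exp (-(t⁻¹ ^ n / 2))) * t ^ 2 := by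
        rw [pow_add]
        field_simp
      rw [e, ← mul_assoc]
      gcongr
    · rw [flatDeriv, if_neg ht, abs_zero]
      positivity

theorem hasDerivAt_flatDeriv {n : ℕ} (hn : 2 ≤ n) (k : ℕ) (t : ℝ) :
    HasDerivAt (flatDeriv n k) (flatDeriv n (k + 1) t) t := by
  rcases lt_trichotomy t 0 with ht | rfl | ht
  · rw [flatDeriv, if_neg ht.not_gt]
    refine (hasDerivAt_const t (0 : ℝ)).congr_of_eventuallyEq ?_
    filter_upwards [Iio_mem_nhds ht] with s hs
    exact if_neg (not_lt.2 (le_of_lt hs))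
  · rw [flatDeriv, if_neg (lt_irrefl _)]
    obtain ⟨-, -, -, hB⟩ := exists_flatDeriv_bound hn
    obtain ⟨B, hB⟩ := hB k
    exact hasDerivAt_zero_of_abs_le_sq B hB
  · rw [flatDeriv, if_pos ht]
    refine (hasDerivAt_iteratedDeriv_flatExp n k
      (by exact_mod_cast ht.ne' : (t : ℂ) ≠ 0)).real_of_complex.congr_of_eventuallyEq ?_
    filter_upwards [Ioi_mem_nhds ht] with s hs
    exact if_pos hs

/-- The `j`-th time derivative at `x ≥ 0` of the odd lattice solution whose value at `x = 1`
has successive derivatives `g`. -/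
def latticeSol (g : ℕ → ℝ → ℝ) : ℕ → ℕ → ℝ → ℝ
  | 0, _, _ => 0
  | 1, j, t => g j t
  | x + 2, j, t => latticeSol g (x + 1) (j + 1) t + 2 * latticeSol g (x + 1) j t
      - latticeSol g x j t

theorem hasDerivAt_latticeSol {g : ℕ → ℝ → ℝ} (hg : ∀ k t, HasDerivAt (g k) (g (k + 1) t) t)
    (x j : ℕ) (t : ℝ) :
    HasDerivAt (latticeSol g x j) (latticeSol g x (j + 1) t) t := by
  induction x using Nat.twoStepInduction generalizing j with
  | zero => exact hasDerivAt_const t 0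
  | one => exact hg j t
  | more x h0 h1 => exact ((h1 (j + 1)).add ((h1 j).const_mul 2)).sub (h0 j)

theorem latticeSol_eq_zero {g : ℕ → ℝ → ℝ} {t : ℝ} (hg : ∀ k, g k t = 0) (x j : ℕ) :
    latticeSol g x j t = 0 := by
  induction x using Nat.twoStepInduction generalizing j with
  | zero => rfl
  | one => exact hg j
  | more x h0 h1 => simp [latticeSol, h0, h1]

theorem abs_latticeSol_le {g : ℕ → ℝ → ℝ} {K : ℕ → ℝ} (hK : Monotone K)
    (hg : ∀ k t, |g k t| ≤ K k) (x j : ℕ) (t : ℝ) :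
    |latticeSol g x j t| ≤ 4 ^ x * K (x + j) := by
  have hK0 : ∀ k, 0 ≤ K k := fun k => (abs_nonneg _).trans (hg k 0)
  induction x using Nat.twoStepInduction generalizing j with
  | zero => simpa [latticeSol] using hK0 j
  | one =>
    have h1 : K j ≤ K (1 + j) := hK (by omega)
    have h2 : |latticeSol g 1 j t| ≤ K j := hg j t
    have := hK0 j
    linarith
  | more x h0 h1 =>
    have a := h1 (j + 1)
    have b := h1 j
    have c := h0 j
    have hp : (0 : ℝ) < 4 ^ x := by positivity
    have ka : K (x + 1 + (j + 1)) = K (x + 2 + j) := by congr 1; omega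
    have kb := mul_le_mul_of_nonneg_left (hK (by omega : x + 1 + j ≤ x + 2 + j)) hp.le
    have kc := mul_le_mul_of_nonneg_left (hK (by omega : x + j ≤ x + 2 + j)) hp.le
    have kd := mul_nonneg hp.le (hK0 (x + 2 + j))
    rw [ka] at a
    rw [pow_succ] at a b
    rw [latticeSol, pow_add]
    rw [abs_le] at *
    constructor <;> nlinarith

theorem iteratedDeriv_latticeSol {g : ℕ → ℝ → ℝ}
    (hg : ∀ k t, HasDerivAt (g k) (g (k + 1) t) t) (x j : ℕ) :
    iteratedDeriv j (latticeSol g x 0) = latticeSol g x j := by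
  induction j with
  | zero => exact iteratedDeriv_zero
  | succ j ih =>
    rw [iteratedDeriv_succ, ih]
    exact funext fun t => (hasDerivAt_latticeSol hg x j t).deriv

theorem contDiff_latticeSol {g : ℕ → ℝ → ℝ}
    (hg : ∀ k t, HasDerivAt (g k) (g (k + 1) t) t) (x : ℕ) :
    ContDiff ℝ (⊤ : ℕ∞) (latticeSol g x 0) :=
  contDiff_of_differentiable_iteratedDeriv fun j _ => by
    rw [iteratedDeriv_latticeSol hg]
    exact fun t => (hasDerivAt_latticeSol hg x j t).differentiableAt

/-- The odd extension to `ℤ` of `latticeSol g`. -/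
def oddLatticeSol (g : ℕ → ℝ → ℝ) : ℤ → ℝ → ℝ
  | Int.ofNat x => latticeSol g x 0
  | Int.negSucc x => -latticeSol g (x + 1) 0

theorem oddLatticeSol_natCast (g : ℕ → ℝ → ℝ) (x : ℕ) :
    oddLatticeSol g x = latticeSol g x 0 := rfl

theorem oddLatticeSol_neg_natCast (g : ℕ → ℝ → ℝ) (x : ℕ) :
    oddLatticeSol g (-x) = -latticeSol g x 0 := by
  cases x with
  | zero => exact (neg_zero (G := ℝ → ℝ)).symm
  | succ x => rfl

theorem contDiff_oddLatticeSol {g : ℕ → ℝ → ℝ}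
    (hg : ∀ k t, HasDerivAt (g k) (g (k + 1) t) t) (x : ℤ) :
    ContDiff ℝ (⊤ : ℕ∞) (oddLatticeSol g x) := by
  obtain ⟨m, rfl | rfl⟩ := x.eq_nat_or_neg
  · exact contDiff_latticeSol hg m
  · rw [oddLatticeSol_neg_natCast]
    exact (contDiff_latticeSol hg m).neg

theorem iteratedDeriv_oddLatticeSol_eq_zero {g : ℕ → ℝ → ℝ}
    (hg : ∀ k t, HasDerivAt (g k) (g (k + 1) t) t) {t : ℝ} (h0 : ∀ k, g k t = 0)
    (x : ℤ) (j : ℕ) : iteratedDeriv j (oddLatticeSol g x) t = 0 := by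
  obtain ⟨m, rfl | rfl⟩ := x.eq_nat_or_neg
  · rw [oddLatticeSol_natCast, iteratedDeriv_latticeSol hg, latticeSol_eq_zero h0]
  · rw [oddLatticeSol_neg_natCast, iteratedDeriv_neg, iteratedDeriv_latticeSol hg,
      latticeSol_eq_zero h0, neg_zero]

theorem hasDerivAt_oddLatticeSol {g : ℕ → ℝ → ℝ}
    (hg : ∀ k t, HasDerivAt (g k) (g (k + 1) t) t) (x : ℤ) (t : ℝ) :
    HasDerivAt (oddLatticeSol g x) (oddLatticeSol g (x + 1) t + oddLatticeSol g (x - 1) t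
      - 2 * oddLatticeSol g x t) t := by
  obtain ⟨m, rfl | rfl⟩ := x.eq_nat_or_neg <;> rcases m with _ | m
  · refine (hasDerivAt_const t (0 : ℝ)).congr_deriv ?_
    change 0 = g 0 t + -g 0 t - 2 * 0
    ring
  · have e : ((m + 1 : ℕ) : ℤ) - 1 = (m : ℕ) := by push_cast; ring
    have e' : ((m + 1 : ℕ) : ℤ) + 1 = (m + 2 : ℕ) := by push_cast; ring
    rw [e, e']
    simp only [oddLatticeSol_natCast]
    refine (hasDerivAt_latticeSol hg (m + 1) 0 t).congr_deriv ?_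
    rw [latticeSol]
    ring
  · refine (hasDerivAt_const t (0 : ℝ)).congr_deriv ?_
    change 0 = g 0 t + -g 0 t - 2 * 0
    ring
  · have e : -((m + 1 : ℕ) : ℤ) + 1 = -(m : ℕ) := by push_cast; ring
    have e' : -((m + 1 : ℕ) : ℤ) - 1 = -(m + 2 : ℕ) := by push_cast; ring
    rw [e, e']
    simp only [oddLatticeSol_neg_natCast, Pi.neg_apply]
    refine (hasDerivAt_latticeSol hg (m + 1) 0 t).neg.congr_deriv ?_
    rw [latticeSol]
    ring

theorem monotone_natCast_mul_log : Monotone fun k : ℕ => (k : ℝ) * log k :=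
  monotone_nat_of_le_succ fun k => by
    rcases Nat.eq_zero_or_pos k with rfl | hk
    · simp
    have : (1 : ℝ) ≤ k := by exact_mod_cast hk
    have := log_nonneg this
    push_cast
    gcongr <;> linarith

/-- sharpness of the growth condition: for every ε > 0 there is
an entire solution of the heat equation on ℤ of growth exp((1+ε)·x·ln x) that
is not analytic in time. -/
theorem sharpness_example :
    ∀ ε : ℝ, 0 < ε → ∃ β : ℝ, β > max 1 (2 / ε) ∧
      ∃ A : ℝ, 0 < A ∧ ∃ R₀ : ℝ, 0 < R₀ ∧ ∃ u : ℤ → ℝ → ℝ,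
        (∀ x, ContDiff ℝ (⊤ : ℕ∞) (u x)) ∧
        (∀ (x : ℤ) (t : ℝ),
          HasDerivAt (fun s => u x s) (u (x + 1) t + u (x - 1) t - 2 * u x t) t) ∧
        (∀ (x : ℤ) (t : ℝ), R₀ ≤ (x : ℝ) →
          |u x t| ≤ A * Real.exp ((1 + ε) * (x : ℝ) * Real.log (x : ℝ))) ∧
        ∃ t₀ : ℝ, (∀ (x : ℤ) (j : ℕ), iteratedDeriv j (u x) t₀ = 0) ∧
          ∀ δ : ℝ, 0 < δ → ∃ (x : ℤ) (t : ℝ), t ∈ Set.Ioo t₀ (t₀ + δ) ∧ u x t ≠ 0 := by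
  intro ε hε
  obtain ⟨m, hm⟩ := exists_nat_gt (1 / ε)
  set n := m + 2 with hn
  have hn2 : 2 ≤ n := by omega
  have hn0 : (0 : ℝ) < n := by positivity
  have hnε : 0 < ε - 1 / n := by
    have : 1 / ε < n := hm.trans (by rw [hn]; push_cast; linarith)
    rw [sub_pos, div_lt_iff₀ hn0]
    rw [div_lt_iff₀ hε] at this
    linarith
  obtain ⟨C, hC, hbound, -⟩ := exists_flatDeriv_bound hn2
  have hder := hasDerivAt_flatDeriv hn2
  have hK : Monotone fun k : ℕ => C ^ k * exp ((1 + 1 / n) * (k * log k)) := fun a b hab => by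
    have := monotone_natCast_mul_log hab
    dsimp only at this ⊢
    gcongr
  refine ⟨max 1 (2 / ε) + 1, by linarith, 1, one_pos,
    max 1 (exp (log (4 * C) / (ε - 1 / n))), by positivity, oddLatticeSol (flatDeriv n),
    contDiff_oddLatticeSol hder, hasDerivAt_oddLatticeSol hder, fun x t hx => ?_, 0,
    iteratedDeriv_oddLatticeSol_eq_zero hder fun k => if_neg (lt_irrefl _),
    fun δ hδ => ⟨1, δ / 2, by constructor <;> linarith, ?_⟩⟩
  · have hx1 : (1 : ℝ) ≤ x := (le_max_left _ _).trans hx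
    lift x to ℕ using by exact_mod_cast zero_le_one.trans hx1
    rw [Int.cast_natCast] at *
    have hlog : log (4 * C) ≤ (ε - 1 / n) * log x := by
      have := (le_log_iff_exp_le (by linarith)).2 ((le_max_right _ _).trans hx)
      rwa [div_le_iff₀' hnε] at this
    calc |latticeSol (flatDeriv n) x 0 t|
        ≤ 4 ^ x * (C ^ x * exp ((1 + 1 / n) * (x * log x))) :=
          abs_latticeSol_le hK hbound x 0 t
      _ = exp (x * log (4 * C) + (1 + 1 / n) * (x * log x)) := by
          rw [exp_add, exp_nat_mul, exp_log (by positivity), mul_pow, mul_assoc]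
      _ ≤ 1 * exp ((1 + ε) * x * log x) := by
          rw [one_mul, exp_le_exp]
          have := mul_le_mul_of_nonneg_left hlog (by linarith : (0 : ℝ) ≤ x)
          linarith
  · change flatDeriv n 0 (δ / 2) ≠ 0
    rw [flatDeriv, if_pos (half_pos hδ), iteratedDeriv_zero, flatExp,
      show -(((δ / 2 : ℝ) : ℂ)⁻¹ ^ n) = ((-((δ / 2)⁻¹ ^ n) : ℝ) : ℂ) by push_cast; rfl,
      Complex.exp_ofReal_re]
    exact exp_ne_zero _
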